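/- arXiv:2008.11041 — 3 statements merged into one kernel-verified Lean document; each statement's English description precedes it below -/
import Mathlib

section
/- Let R be a left Noetherian ring, let N be a two-sided ideal of R with N^d = 0 for some d ≥ 1, and let W be a subring of R such that R/N is finitely generated as a left module over the image of W in R/N. Then for every e with 0 ≤ e ≤ d, the ideal power N^e is finitely generated as a left W-module; in particular R itself is finitely generated as a left W-module. -/
/-- The products of `e` elements of a two-sided ideal. -/
def TwoSidedIdeal.products {R : Type*} [Ring R] (N : TwoSidedIdeal R) (e : ℕ) : Set R :=
  {x : R | ∃ f : Fin e → R, (∀ i, f i ∈ N) ∧ x = (List.ofFn f).prod}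

namespace TwoSidedIdeal

variable {R : Type*} [Ring R] {N : TwoSidedIdeal R}

theorem mul_mem_products {n x : R} {e : ℕ} (hn : n ∈ N) (hx : x ∈ N.products e) :
    n * x ∈ N.products (e + 1) := by
  obtain ⟨f, hf, rfl⟩ := hx
  refine ⟨Fin.cons n f, Fin.cases hn hf, ?_⟩
  simp [List.ofFn_succ]

theorem mul_mem_products_of_pos {x : R} {e : ℕ} (he : e ≠ 0) (r : R) (hx : x ∈ N.products e) :
    r * x ∈ N.products e := by
  obtain ⟨k, rfl⟩ := Nat.exists_eq_succ_of_ne_zero he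
  obtain ⟨f, hf, rfl⟩ := hx
  refine ⟨Fin.cons (r * f 0) (Fin.tail f),
    Fin.cases (N.mul_mem_left _ _ (hf 0)) fun i => hf i.succ, ?_⟩
  simp [List.ofFn_succ, Fin.tail, mul_assoc]

theorem span_products_zero : Ideal.span (N.products 0) = ⊤ :=
  (Ideal.eq_top_iff_one _).2 (Ideal.subset_span ⟨Fin.elim0, fun i => i.elim0, by simp⟩)

theorem restrictScalars_span_products (W : Subring R) {e : ℕ} (he : e ≠ 0) :
    (Ideal.span (N.products e)).restrictScalars W = Submodule.span W (N.products e) := by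
  refine le_antisymm (fun x hx => ?_) (Submodule.span_le_restrictScalars W R _)
  refine Submodule.closure_induction (p := fun x _ => x ∈ Submodule.span W (N.products e))
    (Submodule.zero_mem _) (fun _ _ _ _ => Submodule.add_mem _) (fun r x hx => ?_) hx
  exact Submodule.subset_span (mul_mem_products_of_pos he r hx)

theorem mul_mem_span_products_succ {n x : R} {e : ℕ} (hn : n ∈ N)
    (hx : x ∈ Ideal.span (N.products e)) : n * x ∈ Ideal.span (N.products (e + 1)) := by
  refine Submodule.closure_induction
    (p := fun x _ => n * x ∈ Ideal.span (N.products (e + 1)))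
    (by simp) (fun _ _ _ _ hx hy => by rw [mul_add]; exact Submodule.add_mem _ hx hy)
    (fun r x hx => ?_) hx
  rw [smul_eq_mul, ← mul_assoc]
  exact Ideal.subset_span (mul_mem_products (N.mul_mem_right _ _ hn) hx)

theorem span_products_succ_le (e : ℕ) :
    Ideal.span (N.products (e + 1)) ≤ Ideal.span (N.products e) := by
  refine Ideal.span_le.2 ?_
  rintro _ ⟨f, hf, rfl⟩
  rw [List.ofFn_succ, List.prod_cons]
  exact Ideal.mul_mem_left _ _ (Ideal.subset_span ⟨_, fun i => hf i.succ, rfl⟩)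

end TwoSidedIdeal

/-- If `Q` is finite over the image of `W` under a surjection `π : R → Q`, then some finitely
generated `W`-submodule of `R` surjects onto `Q`. -/
theorem Subring.exists_fg_submodule_of_finite_map {R Q : Type*} [Ring R] [Ring Q] (W : Subring R)
    (π : R →+* Q) (hπ : Function.Surjective π) (hfg : Module.Finite (W.map π) Q) :
    ∃ S : Submodule W R, S.FG ∧ ∀ q : Q, ∃ s ∈ S, π s = q := by
  classical
  obtain ⟨T, hT⟩ := hfg.fg_top
  choose g hg using hπ
  refine ⟨Submodule.span W (T.image g), ⟨_, rfl⟩, fun q => ?_⟩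
  have hq : q ∈ Submodule.span (W.map π) (T : Set Q) := hT ▸ Submodule.mem_top
  induction hq using Submodule.span_induction with
  | mem x hx => exact ⟨g x, Submodule.subset_span (by simpa using ⟨x, hx, rfl⟩), hg x⟩
  | zero => exact ⟨0, zero_mem _, map_zero π⟩
  | add x y _ _ hx hy =>
    obtain ⟨a, ha, rfl⟩ := hx
    obtain ⟨b, hb, rfl⟩ := hy
    exact ⟨a + b, add_mem ha hb, map_add π a b⟩
  | smul c x _ hx =>
    obtain ⟨a, ha, rfl⟩ := hx
    obtain ⟨_, w, hw, rfl⟩ := c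
    exact ⟨(⟨w, hw⟩ : W) • a, Submodule.smul_mem _ _ ha, map_mul π w a⟩

/-- A finitely generated left ideal `M` is finitely generated over `W` if `R` is finitely generated
over `W` modulo `N` and `N * M` lies in a left ideal `M' ≤ M` finitely generated over `W`. -/
theorem Ideal.fg_restrictScalars_of_mul_mem {R : Type*} [Ring R] {W : Subring R}
    {N : TwoSidedIdeal R} {S : Submodule W R} (hS : S.FG) (hSN : ∀ r : R, ∃ s ∈ S, r - s ∈ N)
    {M M' : Ideal R} (hM : M.FG) (hM' : (M'.restrictScalars W).FG) (hle : M' ≤ M)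
    (hmul : ∀ n ∈ N, ∀ m ∈ M, n * m ∈ M') : (M.restrictScalars W).FG := by
  obtain ⟨T, rfl⟩ := hM
  let φ (t : R) : R →ₗ[W] R := (LinearMap.toSpanSingleton R R t).restrictScalars W
  have key : (Ideal.span (T : Set R)).restrictScalars W =
      (⨆ t ∈ T, S.map (φ t)) ⊔ M'.restrictScalars W := by
    refine le_antisymm (fun x hx => ?_) (sup_le (iSup₂_le fun t ht => ?_) hle)
    · refine Submodule.closure_induction
        (p := fun x _ => x ∈ (⨆ t ∈ T, S.map (φ t)) ⊔ M'.restrictScalars W)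
        (zero_mem _) (fun _ _ _ _ => add_mem) (fun r t ht => ?_) hx
      obtain ⟨s, hs, hrs⟩ := hSN r
      rw [← add_sub_cancel s r, add_smul]
      refine Submodule.add_mem_sup ?_ (hmul _ hrs t (Ideal.subset_span ht))
      exact le_iSup₂ (f := fun t (_ : t ∈ T) => S.map (φ t)) t ht ⟨s, hs, rfl⟩
    · rintro _ ⟨s, -, rfl⟩
      exact Ideal.mul_mem_left _ s (Ideal.subset_span ht)
  exact key ▸ (Submodule.fg_biSup T _ fun t _ => hS.map (φ t)).sup hM'

/-- Let `R` be a left Noetherian ring, `N` a two-sided ideal with `N^d = 0`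
for some `d ≥ 1`, and `W ⊆ R` a subring such that `R/N` (presented as a surjective image `Q`
of `R` with kernel `N`) is finitely generated as a left module over the image of `W`.
Then for every `0 ≤ e ≤ d` the ideal power `N^e` (with `N^0 = R`) is finitely generated
as a left `W`-module; in particular `R` itself is finitely generated as a left `W`-module. -/
theorem powers_of_nilpotent_ideal_fg_over_subring
    {R : Type*} [Ring R] [IsNoetherianRing R]
    (N : TwoSidedIdeal R) (d : ℕ) (hd : 1 ≤ d)
    (hNnil : ∀ f : Fin d → R, (∀ i, f i ∈ N) → (List.ofFn f).prod = 0)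
    (W : Subring R)
    {Q : Type*} [Ring Q] (π : R →+* Q) (hπ : Function.Surjective π)
    (hker : ∀ x : R, π x = 0 ↔ x ∈ N)
    (hfg : Module.Finite (W.map π) Q) :
    (∀ e : ℕ, e ≤ d →
      (if e = 0 then (⊤ : Submodule W R)
       else Submodule.span W
         {x : R | ∃ f : Fin e → R, (∀ i, f i ∈ N) ∧ x = (List.ofFn f).prod}).FG) ∧
      Module.Finite W R := by
  obtain ⟨S, hS, hSQ⟩ := W.exists_fg_submodule_of_finite_map π hπ hfg
  have hSN (r : R) : ∃ s ∈ S, r - s ∈ N := by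
    obtain ⟨s, hs, h⟩ := hSQ (π r)
    exact ⟨s, hs, (hker _).1 (by rw [map_sub, h, sub_self])⟩
  have hpow (e : ℕ) (he : e ≤ d) : ((Ideal.span (N.products e)).restrictScalars W).FG := by
    induction he using Nat.decreasingInduction with
    | self =>
      have hbot : Ideal.span (N.products d) = ⊥ := by
        refine Ideal.span_eq_bot.2 ?_
        rintro _ ⟨f, hf, rfl⟩
        exact hNnil f hf
      rw [hbot, Submodule.restrictScalars_bot]
      exact Submodule.fg_bot
    | of_succ k _ ih =>
      exact Ideal.fg_restrictScalars_of_mul_mem hS hSN (IsNoetherian.noetherian _) ih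
        (TwoSidedIdeal.span_products_succ_le k)
        fun _ hn _ hm => TwoSidedIdeal.mul_mem_span_products_succ hn hm
  have htop : (⊤ : Submodule W R).FG := by
    simpa [TwoSidedIdeal.span_products_zero] using hpow 0 d.zero_le
  refine ⟨fun e he => ?_, ⟨htop⟩⟩
  split_ifs with h
  · exact htop
  · exact TwoSidedIdeal.restrictScalars_span_products W h ▸ hpow e he
end

section
/- Let F be a field, A an associative unital F-algebra, M an A-bimodule on which F acts centrally, and B : M × M → F an F-bilinear map that is A-balanced, i.e., B(m·a, m') = B(m, a·m') for all a ∈ A and m, m' ∈ M. Then the F-vector space R = F ⊕ M ⊕ F ⊕ A ⊕ M ⊕ F of triangular arrays ((α₁, v, λ), (0, f, w), (0, 0, α₂)) with multiplication ((α₁, v, λ), (0, f, w), (0, 0, α₂)) · ((α₁', v', λ'), (0, f', w'), (0, 0, α₂')) = ((α₁α₁', α₁v' + v·f', α₁λ' + α₂'λ + B(v, w')), (0, ff', f·w' + α₂'w), (0, 0, α₂α₂')) is an associative unital F-algebra. -/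
/-- A triangular array `((α₁, v, λ), (0, f, w), (0, 0, α₂))` with `α₁, λ, α₂ ∈ F`,
`v, w ∈ M`, `f ∈ A`. -/
structure TriArr (F A M : Type*) where
  a11 : F
  a12 : M
  a13 : F
  a22 : A
  a23 : M
  a33 : F

section

variable {F A M : Type*} [Field F] [Ring A] [Algebra F A]
  [AddCommGroup M] [Module F M] [Module A M] [Module Aᵐᵒᵖ M]
  [SMulCommClass A Aᵐᵒᵖ M] [IsScalarTower F A M] [IsScalarTower F Aᵐᵒᵖ M]

/-- The componentwise addition on triangular arrays. -/
def triAdd (x y : TriArr F A M) : TriArr F A M :=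
  ⟨x.a11 + y.a11, x.a12 + y.a12, x.a13 + y.a13, x.a22 + y.a22, x.a23 + y.a23, x.a33 + y.a33⟩

/-- The componentwise `F`-scalar multiplication on triangular arrays. -/
def triSMul (c : F) (x : TriArr F A M) : TriArr F A M :=
  ⟨c * x.a11, c • x.a12, c * x.a13, c • x.a22, c • x.a23, c * x.a33⟩

/-- The multiplication of triangular arrays determined by the `A`-balanced
`F`-bilinear map `B : M × M → F`:
`((α₁, v, λ), (0, f, w), (0, 0, α₂)) · ((α₁', v', λ'), (0, f', w'), (0, 0, α₂')) =
 ((α₁α₁', α₁v' + v·f', α₁λ' + α₂'λ + B(v, w')), (0, ff', f·w' + α₂'w), (0, 0, α₂α₂'))`,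
where `v·f'` is the right `A`-action and `f·w'` the left `A`-action. -/
def triMul (B : M →ₗ[F] M →ₗ[F] F) (x y : TriArr F A M) : TriArr F A M :=
  ⟨x.a11 * y.a11,
   x.a11 • y.a12 + MulOpposite.op y.a22 • x.a12,
   x.a11 * y.a13 + y.a33 * x.a13 + B x.a12 y.a23,
   x.a22 * y.a22,
   x.a22 • y.a23 + y.a33 • x.a23,
   x.a33 * y.a33⟩

/-- The multiplicative unit `((1,0,0),(0,1,0),(0,0,1))`. -/
def triOne : TriArr F A M := ⟨1, 0, 0, 1, 0, 1⟩

/-- Let `F` be a field, `A` an associative unital `F`-algebra, `M` an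
`A`-bimodule on which `F` acts centrally, and `B : M × M → F` an `F`-bilinear, `A`-balanced
map.  Then the triangular arrays `((α₁, v, λ), (0, f, w), (0, 0, α₂))` with the
multiplication above form an associative unital `F`-algebra: the multiplication is
associative, unital, biadditive and `F`-bilinear. -/
theorem triangular_arrays_form_associative_unital_algebra
    (B : M →ₗ[F] M →ₗ[F] F)
    (hB : ∀ (a : A) (m m' : M), B (MulOpposite.op a • m) m' = B m (a • m')) :
    (∀ x y z : TriArr F A M, triMul B (triMul B x y) z = triMul B x (triMul B y z)) ∧
    (∀ x : TriArr F A M, triMul B triOne x = x) ∧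
    (∀ x : TriArr F A M, triMul B x triOne = x) ∧
    (∀ x y z : TriArr F A M, triMul B x (triAdd y z) = triAdd (triMul B x y) (triMul B x z)) ∧
    (∀ x y z : TriArr F A M, triMul B (triAdd x y) z = triAdd (triMul B x z) (triMul B y z)) ∧
    (∀ (c : F) (x y : TriArr F A M), triMul B (triSMul c x) y = triSMul c (triMul B x y)) ∧
    (∀ (c : F) (x y : TriArr F A M), triMul B x (triSMul c y) = triSMul c (triMul B x y)) := by
  have : SMulCommClass F A M := IsScalarTower.to_smulCommClass
  have : SMulCommClass A F M := SMulCommClass.symm _ _ _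
  have : SMulCommClass F Aᵐᵒᵖ M := IsScalarTower.to_smulCommClass
  have : SMulCommClass Aᵐᵒᵖ F M := SMulCommClass.symm _ _ _
  refine ⟨fun x y z => ?_, fun x => ?_, fun x => ?_, fun x y z => ?_, fun x y z => ?_,
    fun c x y => ?_, fun c x y => ?_⟩
  · simp only [triMul, TriArr.mk.injEq]
    refine ⟨mul_assoc _ _ _, ?_, ?_, mul_assoc _ _ _, ?_, mul_assoc _ _ _⟩
    · rw [smul_add, smul_add, mul_smul, MulOpposite.op_mul, mul_smul,
        smul_comm (MulOpposite.op z.a22) x.a11]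
      abel
    · simp only [map_add, map_smul, LinearMap.add_apply, LinearMap.smul_apply, smul_eq_mul, hB]
      ring
    · rw [smul_add, smul_add, mul_smul, smul_comm x.a22 z.a33, mul_comm y.a33, mul_smul]
      abel
  · simp [triMul, triOne]
  · simp [triMul, triOne]
  · simp only [triMul, triAdd, TriArr.mk.injEq, mul_add, add_mul, smul_add, add_smul,
      MulOpposite.op_add, map_add, true_and, and_true]
    refine ⟨?_, ?_, ?_⟩ <;> abel
  · simp only [triMul, triAdd, TriArr.mk.injEq, mul_add, add_mul, smul_add, add_smul,
      map_add, LinearMap.add_apply, true_and, and_true]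
    refine ⟨?_, ?_, ?_⟩ <;> abel
  · simp only [triMul, triSMul, TriArr.mk.injEq, smul_add, map_smul, LinearMap.smul_apply,
      smul_eq_mul, smul_mul_assoc, smul_assoc, mul_smul, mul_assoc, true_and, and_true]
    refine ⟨?_, ?_, ?_⟩
    · rw [smul_comm c (MulOpposite.op y.a22)]
    · ring
    · rw [smul_comm c y.a33]
  · simp only [triMul, triSMul, TriArr.mk.injEq, smul_add, map_smul, smul_eq_mul,
      mul_smul_comm, MulOpposite.op_smul, smul_assoc, mul_smul, true_and]
    refine ⟨?_, ?_, ?_, ?_, ?_⟩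
    · ring
    · rw [smul_comm c x.a11]
    · ring
    · rw [smul_comm c x.a22]
    · ring


end
end

section
/- Let F be a field and let A be an affine (finitely generated) F-algebra. If A is weakly representable, i.e., there exist n ≥ 1, a commutative ring C, and an injective ring homomorphism A → M_n(C), then A satisfies the ascending chain condition on left annihilators: every ascending chain of subsets of A of the form ann(S) = {a ∈ A : aS = 0} stabilizes. -/
open scoped TensorProduct in
/-- Elements of a field `F` acting centrally in `A` and finitely many scalars of `C` generate
a commutative subring of the matrix ring, the image of a polynomial ring over `F`, which
centralizes the image of `A`. -/
theorem exists_mvPolynomial_ringHom_commute {F A C σ ι : Type*} [Field F] [Ring A] [Algebra F A]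
    [CommRing C] [Fintype ι] [DecidableEq ι] (f : A →+* Matrix ι ι C) (c : σ → C) :
    ∃ ψ : MvPolynomial σ F →+* Matrix ι ι C,
      (∀ q, ψ (MvPolynomial.C q) = f (algebraMap F A q)) ∧
      (∀ s, ψ (MvPolynomial.X s) = Matrix.scalar ι (c s)) ∧
      ∀ p a, Commute (ψ p) (f a) := by
  let Φ : F ⊗[ℤ] C →ₐ[ℤ] Matrix ι ι C := Algebra.TensorProduct.lift
    (f.comp (algebraMap F A)).toIntAlgHom (Matrix.scalar ι).toIntAlgHom
    fun x y => (Matrix.scalar_commute y (fun r => Commute.all _ _) _).symm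
  let ψ := (Φ : F ⊗[ℤ] C →+* Matrix ι ι C).comp
    (MvPolynomial.eval₂Hom (Algebra.TensorProduct.includeLeftRingHom : F →+* F ⊗[ℤ] C)
      fun s => (1 : F) ⊗ₜ[ℤ] c s)
  have hΦ : ∀ x y, Φ (x ⊗ₜ[ℤ] y) = f (algebraMap F A x) * Matrix.scalar ι y :=
    Algebra.TensorProduct.lift_tmul _ _ _
  have hC : ∀ q, ψ (MvPolynomial.C q) = f (algebraMap F A q) := fun q => by simp [ψ, hΦ]
  have hX : ∀ s, ψ (MvPolynomial.X s) = Matrix.scalar ι (c s) := fun s => by simp [ψ, hΦ]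
  refine ⟨ψ, hC, hX, fun p a => ?_⟩
  induction p using MvPolynomial.induction_on with
  | C q =>
    rw [hC]
    exact (Algebra.commute_algebraMap_left q a).map f
  | add p q hp hq => rw [map_add]; exact hp.add_left hq
  | mul_X p s hp =>
    rw [map_mul, hX]
    exact hp.mul_left (Matrix.scalar_commute (c s) (fun r => Commute.all _ _) _)

/-- The ring of a weakly representable affine algebra lies in a finitely generated submodule of
the matrix ring over a Noetherian ring mapping to the matrix ring. -/
theorem exists_mvPolynomial_ringHom_span_single {F A C ι : Type*} [Field F] [Ring A] [Algebra F A]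
    [CommRing C] [Fintype ι] [DecidableEq ι] (T : Finset A)
    (hT : Algebra.adjoin F (T : Set A) = ⊤) (f : A →+* Matrix ι ι C) :
    ∃ ψ : MvPolynomial (T × ι × ι) F →+* Matrix ι ι C,
      letI := Module.compHom (Matrix ι ι C) ψ
      ∀ a, f a ∈ Submodule.span (MvPolynomial (T × ι × ι) F)
        (Set.range fun k : ι × ι => (Matrix.single k.1 k.2 1 : Matrix ι ι C)) := by
  obtain ⟨ψ, hC, hX, hcomm⟩ := exists_mvPolynomial_ringHom_commute (F := F) f
    fun k : T × ι × ι => f k.1 k.2.1 k.2.2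
  refine ⟨ψ, ?_⟩
  let := Module.compHom (Matrix ι ι C) ψ
  intro a
  have hsmul : ∀ (p : MvPolynomial (T × ι × ι) F) (x : Matrix ι ι C), p • x = ψ p * x :=
    fun _ _ => rfl
  set N := Submodule.span (MvPolynomial (T × ι × ι) F)
    (Set.range fun k : ι × ι => (Matrix.single k.1 k.2 1 : Matrix ι ι C))
  have hmem : ∀ i j, (Matrix.single i j 1 : Matrix ι ι C) ∈ N :=
    fun i j => Submodule.subset_span ⟨(i, j), rfl⟩
  have hone : (1 : Matrix ι ι C) ∈ N := by
    rw [← Matrix.sum_single_one]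
    exact Submodule.sum_mem _ fun i _ => hmem i i
  have hstable : ∀ x ∈ N, f a * x ∈ N := by
    have ha : a ∈ Algebra.adjoin F (T : Set A) := hT ▸ Algebra.mem_top
    induction ha using Algebra.adjoin_induction with
    | mem t ht =>
      intro x hx
      induction hx using Submodule.span_induction with
      | mem x hx =>
        obtain ⟨⟨i, j⟩, rfl⟩ := hx
        have key : f t * Matrix.single i j 1 =
            ∑ k, (MvPolynomial.X (⟨t, ht⟩, k, i) : MvPolynomial (T × ι × ι) F) •
              (Matrix.single k j 1 : Matrix ι ι C) := by
          ext r s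
          simp [hsmul, hX, Matrix.sum_apply, Matrix.mul_apply, Matrix.single_apply,
            Matrix.diagonal_apply, ite_and]
        rw [key]
        exact Submodule.sum_mem _ fun k _ => Submodule.smul_mem _ _ (hmem k j)
      | zero => simp
      | add x y _ _ hx hy => rw [mul_add]; exact N.add_mem hx hy
      | smul p x _ hx =>
        rw [hsmul, ← mul_assoc, ← (hcomm p t).eq, mul_assoc, ← hsmul]
        exact N.smul_mem p hx
    | algebraMap q =>
      intro x hx
      rw [← hC, ← hsmul]
      exact N.smul_mem _ hx
    | add a b _ _ ha hb =>
      intro x hx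
      rw [map_add, add_mul]
      exact N.add_mem (ha x hx) (hb x hx)
    | mul a b _ _ ha hb =>
      intro x hx
      rw [map_mul, mul_assoc]
      exact ha _ (hb x hx)
  simpa using hstable 1 hone

/-- An affine algebra over a field which is weakly representable
(embeds in `M_n(C)` for a commutative ring `C`) satisfies the ascending chain condition
on left annihilators. -/
theorem weakly_representable_affine_acc_left_annihilators
    {F : Type*} [Field F] {A : Type*} [Ring A] [Algebra F A]
    (haff : Algebra.FiniteType F A)
    (n : ℕ) (hn : 0 < n) (C : Type*) [CommRing C]
    (f : A →+* Matrix (Fin n) (Fin n) C) (hf : Function.Injective f) :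
    ∀ ch : ℕ → Set A,
      (∀ i, ∃ S : Set A, ch i = {a : A | ∀ s ∈ S, a * s = 0}) →
      Monotone ch → ∃ n₀, ∀ m, n₀ ≤ m → ch m = ch n₀ := by
  intro ch hch hmono
  obtain ⟨T, hT⟩ := haff.out
  obtain ⟨ψ, hψ⟩ := exists_mvPolynomial_ringHom_span_single T hT f
  let := Module.compHom (Matrix (Fin n) (Fin n) C) ψ
  set N := Submodule.span (MvPolynomial (T × Fin n × Fin n) F)
    (Set.range fun k : Fin n × Fin n => (Matrix.single k.1 k.2 1 : Matrix (Fin n) (Fin n) C))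
  have : IsNoetherian (MvPolynomial (T × Fin n × Fin n) F) N :=
    isNoetherian_span_of_finite _ (Set.finite_range _)
  let L : ℕ →o Submodule (MvPolynomial (T × Fin n × Fin n) F) N :=
    ⟨fun i => (Submodule.span _ (f '' ch i)).comap N.subtype, fun i j hij =>
      Submodule.comap_mono (Submodule.span_mono (Set.image_mono (hmono hij)))⟩
  obtain ⟨n₀, hn₀⟩ := monotone_stabilizes_iff_noetherian.mpr this L
  refine ⟨n₀, fun m hm => Set.Subset.antisymm (fun a ha => ?_) (hmono hm)⟩
  have hmem : (⟨f a, hψ a⟩ : N) ∈ L n₀ := by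
    rw [hn₀ m hm]
    exact Submodule.subset_span ⟨a, ha, rfl⟩
  replace hmem : f a ∈ Submodule.span (MvPolynomial (T × Fin n × Fin n) F) (f '' ch n₀) := hmem
  obtain ⟨S, hS⟩ := hch n₀
  rw [hS]
  intro s hs
  apply hf
  rw [map_mul, map_zero]
  generalize f a = x at hmem ⊢
  induction hmem using Submodule.span_induction with
  | mem x hx =>
    obtain ⟨b, hb, rfl⟩ := hx
    rw [hS] at hb
    rw [← map_mul, hb s hs, map_zero]
  | zero => exact zero_mul _
  | add x y _ _ hx hy => rw [add_mul, hx, hy, add_zero]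
  | smul p x _ hx =>
    change ψ p * x * f s = 0
    rw [mul_assoc, hx, mul_zero]
end
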